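/- Let G be a torsion nilpotent group of nilpotency class n and let φ be an endomorphism of G. Then h(φ) = h(φ↾_{γ_n(G)}) + h(φ̄), where γ_n(G) is the n-th term of the lower central series of G (defined by γ_1(G) = G and γ_{i+1}(G) = [γ_i(G), G]) and φ̄ is the endomorphism induced by φ on G/γ_n(G). -/

import Mathlib

open scoped Pointwise ENNReal

/-- A group is *locally finite* if every finitely generated subgroup is finite. -/
def IsLocallyFinite (G : Type*) [Group G] : Prop :=
  ∀ S : Set G, S.Finite → (Subgroup.closure S : Set G).Finite

namespace AlgEntropy

variable {G : Type*} [Group G]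

/-- `entTraj φ F n` is the `n`-th trajectory `T_n(φ,F) = F·φ(F)···φ^{n-1}(F)`
(with `T_0 = {1}`). -/
def entTraj (φ : G →* G) (F : Set G) : ℕ → Set G
  | 0 => {1}
  | n + 1 => entTraj φ F n * (⇑φ)^[n] '' F

/-- The algebraic entropy of `φ` with respect to a subgroup `F`:
`H(φ,F) = lim_n (1/n)·log|T_n(φ,F)|` (the limit exists when `G` is locally
finite and `F` is finite, and then it coincides with this `limsup`). -/
noncomputable def entH (φ : G →* G) (F : Subgroup G) : ℝ :=
  Filter.limsup (fun n : ℕ => Real.log (entTraj φ (F : Set G) n).ncard / n) Filter.atTop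

/-- The algebraic entropy `h(φ) = sup { H(φ,F) : F ≤ G finite }`, valued in `[0,∞]`. -/
noncomputable def algEnt (φ : G →* G) : ℝ≥0∞ :=
  ⨆ (F : Subgroup G) (_ : (F : Set G).Finite), ENNReal.ofReal (entH φ F)

/-- The restriction of an endomorphism `φ` to a `φ`-invariant subgroup `H`. -/
def endRestrict (φ : G →* G) (H : Subgroup G) (hH : H ≤ H.comap φ) : H →* H :=
  (φ.domRestrict H).codRestrict H (fun x => hH x.2)

/-- The entropy of the endomorphism induced by `φ` on the quotient `G ⧸ H`. -/
noncomputable def entQuot (φ : G →* G) (H : Subgroup G) (hN : H.Normal)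
    (hH : H ≤ H.comap φ) : ℝ≥0∞ :=
  letI := hN
  algEnt (QuotientGroup.map H H φ hH)

/-- The Addition Theorem `AT(G,φ,H)`:
`h(φ) = h(φ↾_H) + h(φ̄)` where `φ̄` is induced by `φ` on `G ⧸ H`. -/
def AT (φ : G →* G) (H : Subgroup G) (hN : H.Normal) (hH : H ≤ H.comap φ) : Prop :=
  algEnt φ = algEnt (endRestrict φ H hH) + entQuot φ H hN hH

lemma commutator_le_comap (φ : G →* G) :
    commutator G ≤ (commutator G).comap φ := by
  rw [← Subgroup.map_le_iff_le_comap]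
  calc Subgroup.map φ (commutator G) = ⁅Subgroup.map φ ⊤, Subgroup.map φ ⊤⁆ :=
        Subgroup.map_commutator ⊤ ⊤ φ
    _ ≤ commutator G := Subgroup.commutator_mono le_top le_top

lemma normal_of_le_center {N : Subgroup G} (h : N ≤ Subgroup.center G) : N.Normal := by
  constructor
  intro n hn g
  have hc := Subgroup.mem_center_iff.mp (h hn) g
  have : g * n * g⁻¹ = n := by
    rw [hc]; group
  rwa [this]

lemma center_le_comap_equiv (φ : G ≃* G) :
    Subgroup.center G ≤ (Subgroup.center G).comap φ.toMonoidHom := by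
  intro x hx
  simp only [Subgroup.mem_comap]
  refine Subgroup.mem_center_iff.mpr fun g => ?_
  have hg : φ (φ.symm g) = g := φ.apply_symm_apply g
  calc g * φ x = φ (φ.symm g) * φ x := by rw [hg]
    _ = φ (φ.symm g * x) := by rw [map_mul]
    _ = φ (x * φ.symm g) := by rw [Subgroup.mem_center_iff.mp hx (φ.symm g)]
    _ = φ x * g := by rw [map_mul, hg]

lemma lowerCentralSeries_le_comap (φ : G →* G) (n : ℕ) :
    Subgroup.lowerCentralSeries (⊤ : Subgroup G) n ≤ (Subgroup.lowerCentralSeries (⊤ : Subgroup G) n).comap φ := by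
  rw [← Subgroup.map_le_iff_le_comap]
  induction n with
  | zero => exact le_top
  | succ n ih =>
      show Subgroup.map φ ⁅Subgroup.lowerCentralSeries (⊤ : Subgroup G) n, ⊤⁆ ≤ ⁅Subgroup.lowerCentralSeries (⊤ : Subgroup G) n, ⊤⁆
      rw [Subgroup.map_commutator]
      exact Subgroup.commutator_mono ih le_top

lemma upperCentralSeries_le_comap (φ : G ≃* G) (n : ℕ) :
    upperCentralSeries G n ≤ (upperCentralSeries G n).comap φ.toMonoidHom := by
  have := comap_upperCentralSeries φ n
  -- `(upperCentralSeries G n).comap φ = upperCentralSeries G n`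
  exact le_of_eq this.symm

end AlgEntropy

namespace AlgEntropy
section aux
open Filter Topology

variable {G : Type*} [Group G]

/-- iterate as a hom -/
def iterHom (φ : G →* G) (k : ℕ) : G →* G where
  toFun := φ^[k]
  map_one' := iterate_map_one φ k
  map_mul' := iterate_map_mul φ k

lemma coe_iterHom (φ : G →* G) (k : ℕ) : ⇑(iterHom φ k) = φ^[k] := rfl

lemma image_iter_mul (φ : G →* G) (k : ℕ) (A B : Set G) :
    φ^[k] '' (A * B) = φ^[k] '' A * φ^[k] '' B := by
  rw [← coe_iterHom]; exact Set.image_mul _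

lemma image_iter_iter (φ : G →* G) (k l : ℕ) (A : Set G) :
    φ^[k] '' (φ^[l] '' A) = φ^[k + l] '' A := by
  rw [← Set.image_comp, ← Function.iterate_add]

lemma image_iter_one (φ : G →* G) (k : ℕ) : φ^[k] '' (1 : Set G) = 1 := by
  simp [← Set.singleton_one, ← coe_iterHom]

lemma entTraj_zero (φ : G →* G) (F : Set G) : entTraj φ F 0 = 1 := rfl

lemma entTraj_succ (φ : G →* G) (F : Set G) (n : ℕ) :
    entTraj φ F (n + 1) = entTraj φ F n * φ^[n] '' F := rfl

lemma entTraj_add (φ : G →* G) (F : Set G) (n m : ℕ) :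
    entTraj φ F (n + m) = entTraj φ F n * φ^[n] '' entTraj φ F m := by
  induction m with
  | zero => rw [entTraj_zero, image_iter_one, mul_one, add_zero]
  | succ m ih =>
    rw [← add_assoc, entTraj_succ, ih, entTraj_succ, image_iter_mul, image_iter_iter, mul_assoc]

lemma entTraj_finite (φ : G →* G) {F : Set G} (hF : F.Finite) (n : ℕ) :
    (entTraj φ F n).Finite := by
  induction n with
  | zero => exact Set.finite_singleton _
  | succ n ih => exact ih.mul (hF.image _)

lemma entTraj_nonempty (φ : G →* G) {F : Set G} (hF : F.Nonempty) (n : ℕ) :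
    (entTraj φ F n).Nonempty := by
  induction n with
  | zero => exact Set.singleton_nonempty _
  | succ n ih => exact ih.mul (hF.image _)

lemma one_mem_traj (φ : G →* G) {F : Set G} (hF : (1 : G) ∈ F) (n : ℕ) :
    (1 : G) ∈ entTraj φ F n := by
  induction n with
  | zero => exact rfl
  | succ n ih => exact ⟨1, ih, 1, ⟨1, hF, iterate_map_one φ n⟩, mul_one 1⟩

lemma ncard_mul_le' (A B : Set G) : (A * B).ncard ≤ A.ncard * B.ncard := by
  exact Set.natCard_mul_le (s := A) (t := B)

lemma ncard_traj_le (φ : G →* G) {F : Set G} (hF : F.Finite) (n : ℕ) :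
    (entTraj φ F n).ncard ≤ F.ncard ^ n := by
  induction n with
  | zero => simp [entTraj_zero, ← Set.singleton_one]
  | succ n ih =>
    rw [entTraj_succ, pow_succ]
    exact (ncard_mul_le' _ _).trans (Nat.mul_le_mul ih (Set.ncard_image_le hF))

lemma ncard_traj_pos (φ : G →* G) {F : Set G} (hF : F.Finite) (h : F.Nonempty) (n : ℕ) :
    0 < (entTraj φ F n).ncard :=
  (Set.ncard_pos (entTraj_finite φ hF n)).2 (entTraj_nonempty φ h n)

lemma tendsto_entH (φ : G →* G) (F : Subgroup G) (hF : (F : Set G).Finite) :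
    Tendsto (fun n : ℕ => Real.log (entTraj φ (F : Set G) n).ncard / n) atTop (𝓝 (entH φ F)) := by
  have hne : (F : Set G).Nonempty := ⟨1, F.one_mem⟩
  have hs : Subadditive (fun n : ℕ => Real.log (entTraj φ (F : Set G) n).ncard) := by
    intro m n
    have hm := ncard_traj_pos φ hF hne m
    have hn := ncard_traj_pos φ hF hne n
    have hmn := ncard_traj_pos φ hF hne (m + n)
    dsimp only
    rw [← Real.log_mul (by positivity) (by positivity)]
    apply Real.log_le_log (by positivity)
    rw [entTraj_add]
    exact_mod_cast (ncard_mul_le' _ _).trans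
      (Nat.mul_le_mul le_rfl (Set.ncard_image_le (entTraj_finite φ hF n)))
  have hb : BddBelow (Set.range fun n : ℕ =>
      Real.log (entTraj φ (F : Set G) n).ncard / n) := by
    refine ⟨0, ?_⟩
    rintro _ ⟨n, rfl⟩
    have := Real.log_natCast_nonneg (entTraj φ (F : Set G) n).ncard
    positivity
  have := hs.tendsto_lim hb
  rw [entH, this.limsup_eq]
  exact this

lemma entH_nonneg (φ : G →* G) (F : Subgroup G) (hF : (F : Set G).Finite) : 0 ≤ entH φ F :=
  ge_of_tendsto' (tendsto_entH φ F hF) fun n => by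
    have := Real.log_natCast_nonneg (entTraj φ (F : Set G) n).ncard
    positivity

lemma entH_le (φ : G →* G) (F : Subgroup G) (hF : (F : Set G).Finite) :
    ENNReal.ofReal (entH φ F) ≤ algEnt φ :=
  le_iSup₂ (f := fun (F : Subgroup G) (_ : (F : Set G).Finite) => ENNReal.ofReal (entH φ F)) F hF

/-- the local growth condition -/
def Good (φ : G →* G) : Prop :=
  ∀ F : Subgroup G, (F : Set G).Finite → ∃ (m : ℕ) (A C : Set G), A.Finite ∧ A.Nonempty ∧
    C.Finite ∧ A * φ^[m] '' (F : Set G) ⊆ C * φ '' A ∧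
    ENNReal.ofReal (Real.log C.ncard) ≤ algEnt φ

lemma good_of_comm (φ : G →* G) (hc : ∀ x y : G, x * y = y * x) : Good φ := by
  intro F hF
  have hne : (F : Set G).Nonempty := ⟨1, F.one_mem⟩
  have hnorm : ∀ H : Subgroup G, H.Normal := fun H => ⟨fun n hn g => by
    rw [hc g n, mul_assoc, mul_inv_cancel, mul_one]; exact hn⟩
  have hS : ∀ n, ∃ S : Subgroup G, (S : Set G) = entTraj φ (F : Set G) n := by
    intro n
    induction n with
    | zero => exact ⟨⊥, by simp [entTraj]⟩
    | succ n ih =>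
      obtain ⟨S, hS⟩ := ih
      have := hnorm (F.map (iterHom φ n))
      refine ⟨S ⊔ F.map (iterHom φ n), ?_⟩
      rw [Subgroup.mul_normal, hS, entTraj_succ]; rfl
  choose S hS using hS
  have hSfin : ∀ n, (S n : Set G).Finite := fun n => hS n ▸ entTraj_finite φ hF n
  have hcard : ∀ n, Nat.card (S n) = (entTraj φ (F : Set G) n).ncard := fun n => by
    rw [← hS n]; rfl
  have hle : ∀ n, S n ≤ S (n + 1) := by
    intro n x hx
    have : x ∈ (S (n+1) : Set G) := by
      rw [hS, entTraj_succ, ← hS n]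
      exact ⟨x, hx, 1, ⟨1, F.one_mem, iterate_map_one φ n⟩, mul_one x⟩
    exact this
  have hR := fun n => Subgroup.exists_left_transversal_of_le (hle n)
  choose R hR1 hR2 using hR
  obtain ⟨m, hm⟩ : ∃ m, ∀ n, Nat.card (R m) ≤ Nat.card (R n) :=
    ⟨Function.argmin (fun n => Nat.card (R n)), fun n => Function.argmin_le (fun n => Nat.card (R n)) n⟩
  set c := Nat.card (R m) with hcdef
  have hpow : ∀ n, c ^ n ≤ (entTraj φ (F : Set G) n).ncard := by
    intro n
    induction n with
    | zero => exact ncard_traj_pos φ hF hne 0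
    | succ n ih =>
      rw [← hcard, ← hR2, pow_succ, mul_comm, hcard]
      exact Nat.mul_le_mul (hm n) ih
  have hcpos : 0 < c := by
    rcases Nat.eq_zero_or_pos c with h | h
    · have := hR2 m
      rw [← hcdef, h, zero_mul, hcard] at this
      have := ncard_traj_pos φ hF hne (m+1)
      omega
    · exact h
  have hlogc : Real.log c ≤ entH φ F := by
    refine ge_of_tendsto (tendsto_entH φ F hF) ?_
    filter_upwards [eventually_gt_atTop 0] with n hn
    rw [le_div_iff₀ (by positivity), mul_comm, ← Real.log_pow]
    apply Real.log_le_log (by positivity)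
    exact_mod_cast hpow n
  -- stabilise `k`
  let a : ℕ → ℕ := fun k => (φ^[k] '' (S m : Set G)).ncard
  obtain ⟨k, hk⟩ : ∃ k, ∀ n, a k ≤ a n :=
    ⟨Function.argmin a, fun n => Function.argmin_le _ n⟩
  have hsub : (S m).map (iterHom φ (k + 1)) ≤ (S (m + 1)).map (iterHom φ k) := by
    intro x hx
    obtain ⟨y, hy, rfl⟩ := hx
    refine ⟨φ y, ?_, ?_⟩
    · have : φ y ∈ entTraj φ (F : Set G) (1 + m) := by
        rw [entTraj_add]
        refine ⟨1, ?_, φ y, ⟨y, ?_, rfl⟩, one_mul _⟩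
        · rw [← hS]; exact (S 1).one_mem
        · rw [← hS]; exact hy
      rw [add_comm, ← hS] at this
      exact this
    · change φ^[k] (φ y) = φ^[k+1] y
      rw [Function.iterate_succ_apply]
  obtain ⟨C, hC1, hC2⟩ := Subgroup.exists_left_transversal_of_le hsub
  have e1 : Nat.card ((S m).map (iterHom φ (k + 1))) = a (k + 1) := rfl
  have e2 : Nat.card ((S (m+1)).map (iterHom φ k)) ≤ c * a k := by
    have : ((S (m+1)).map (iterHom φ k) : Set G) = φ^[k] '' (R m) * φ^[k] '' (S m : Set G) := by
      rw [← image_iter_mul, hR1]; rfl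
    change ((S (m+1)).map (iterHom φ k) : Set G).ncard ≤ _
    rw [this]
    refine (ncard_mul_le' _ _).trans (Nat.mul_le_mul ?_ le_rfl)
    exact Set.ncard_image_le (Set.finite_coe_iff.1 (Nat.finite_of_card_ne_zero hcpos.ne'))
  have hapos : 0 < a (k + 1) :=
    (Set.ncard_pos ((hSfin m).image _)).2 ⟨_, 1, (S m).one_mem, rfl⟩
  have e3 : C.ncard ≤ c := by
    rw [e1] at hC2
    have h2 := hk (k + 1)
    have : C.ncard * a (k+1) ≤ c * a (k+1) := by
      calc _ = _ := hC2
        _ ≤ _ := e2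
        _ ≤ _ := Nat.mul_le_mul le_rfl h2
    exact Nat.le_of_mul_le_mul_right this hapos
  have hCfin : C.Finite := by
    apply Set.finite_of_ncard_ne_zero
    intro h
    change C.ncard * _ = _ at hC2
    rw [h, zero_mul] at hC2
    have : 0 < ((S (m+1)).map (iterHom φ k) : Set G).ncard :=
      (Set.ncard_pos ((hSfin (m+1)).image _)).2 ⟨_, 1, (S _).one_mem, rfl⟩
    change 0 = ((S (m+1)).map (iterHom φ k) : Set G).ncard at hC2
    omega
  refine ⟨k + m, φ^[k] '' (S m : Set G), C, (hSfin m).image _, ⟨_, 1, (S m).one_mem, rfl⟩, hCfin,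
    ?_, ?_⟩
  · rw [← image_iter_iter, ← image_iter_mul, hS, ← entTraj_succ, ← hS, ← hS, ← Set.image_comp,
      ← Function.iterate_succ']
    exact hC1.symm.subset
  · refine le_trans (ENNReal.ofReal_le_ofReal ?_) (entH_le φ F hF)
    refine le_trans ?_ hlogc
    rcases Nat.eq_zero_or_pos C.ncard with h | h
    · rw [h]; simpa using Real.log_natCast_nonneg c
    · exact Real.log_le_log (by positivity) (by exact_mod_cast e3)

lemma entTraj_image {H : Type*} [Group H] (f : G →* H) (φ : G →* G) (ψ : H →* H)
    (h : ∀ x, f (φ x) = ψ (f x)) (F : Set G) (n : ℕ) :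
    f '' entTraj φ F n = entTraj ψ (f '' F) n := by
  induction n with
  | zero => simp [entTraj]
  | succ n ih =>
    rw [entTraj_succ, entTraj_succ, Set.image_mul, ih, ← Set.image_comp, ← Set.image_comp]
    congr 2
    exact (Function.Semiconj.iterate_right h n).comp_eq

lemma central_comm {N : Subgroup G} (hN : N ≤ Subgroup.center G) {Z : Set G} (hZ : Z ⊆ N)
    (X : Set G) : Z * X = X * Z := by
  ext x
  constructor
  · rintro ⟨z, hz, y, hy, rfl⟩
    exact ⟨y, hy, z, hz, Subgroup.mem_center_iff.1 (hN (hZ hz)) y⟩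
  · rintro ⟨y, hy, z, hz, rfl⟩
    exact ⟨z, hz, y, hy, (Subgroup.mem_center_iff.1 (hN (hZ hz)) y).symm⟩

lemma image_iter_sub {φ : G →* G} {N : Subgroup G} (hH : N ≤ N.comap φ) {Z : Set G} (hZ : Z ⊆ N)
    (n : ℕ) : φ^[n] '' Z ⊆ N := by
  induction n with
  | zero => simpa using hZ
  | succ n ih =>
    rw [Function.iterate_succ', Set.image_comp]
    rintro _ ⟨x, hx, rfl⟩
    exact hH (ih hx)

lemma entTraj_sub {φ : G →* G} {N : Subgroup G} (hH : N ≤ N.comap φ) {Z : Set G} (hZ : Z ⊆ N)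
    (n : ℕ) : entTraj φ Z n ⊆ N := by
  induction n with
  | zero => simp [entTraj]
  | succ n ih =>
    rintro _ ⟨x, hx, y, hy, rfl⟩
    exact N.mul_mem (ih hx) (image_iter_sub hH hZ n hy)

lemma entTraj_mul_central {φ : G →* G} {N : Subgroup G} (hN : N ≤ Subgroup.center G)
    (hH : N ≤ N.comap φ) {Z : Set G} (hZ : Z ⊆ N) (X : Set G) (n : ℕ) :
    entTraj φ (X * Z) n = entTraj φ X n * entTraj φ Z n := by
  induction n with
  | zero => simp [entTraj]
  | succ n ih =>
    rw [entTraj_succ, ih, image_iter_mul, entTraj_succ, entTraj_succ, mul_assoc, mul_assoc,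
      ← mul_assoc (entTraj φ Z n), central_comm hN (entTraj_sub hH hZ n), mul_assoc]

lemma ncard_mul_ge {N : Subgroup G} [N.Normal] {X Z : Set G} (hX : X.Finite) (hZf : Z.Finite)
    (hZ : Z ⊆ N) :
    ((QuotientGroup.mk' N) '' X).ncard * Z.ncard ≤ (X * Z).ncard := by
  rw [← Set.ncard_prod]
  have hsel : ∀ q : G ⧸ N, ∃ x : G, q ∈ (QuotientGroup.mk' N) '' X →
      x ∈ X ∧ QuotientGroup.mk' N x = q := by
    intro q
    by_cases h : q ∈ (QuotientGroup.mk' N) '' X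
    · obtain ⟨x, hx, hq⟩ := h
      exact ⟨x, fun _ => ⟨hx, hq⟩⟩
    · exact ⟨1, fun h' => absurd h' h⟩
  choose s hs using hsel
  have hz1 : ∀ z ∈ Z, QuotientGroup.mk' N z = 1 := fun z hz =>
    (QuotientGroup.eq_one_iff z).2 (hZ hz)
  refine Set.ncard_le_ncard_of_injOn (fun p : (G ⧸ N) × G => s p.1 * p.2) ?_ ?_ (hX.mul hZf)
  · rintro ⟨q, z⟩ ⟨hq, hz⟩
    exact ⟨s q, (hs q hq).1, z, hz, rfl⟩
  · rintro ⟨q, z⟩ ⟨hq, hz⟩ ⟨q', z'⟩ ⟨hq', hz'⟩ h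
    dsimp only at h hq hq' hz hz'
    have h' := congrArg (QuotientGroup.mk' N) h
    rw [map_mul, map_mul, hz1 z hz, hz1 z' hz', (hs q hq).2, (hs q' hq').2, mul_one, mul_one] at h'
    subst h'
    rw [mul_right_inj] at h
    rw [h]

lemma restrict_semi (φ : G →* G) (N : Subgroup G) (hH : N ≤ N.comap φ) (x : N) :
    N.subtype (endRestrict φ N hH x) = φ (N.subtype x) := rfl

lemma lower_bound (hlf : IsLocallyFinite G) (φ : G →* G) (N : Subgroup G) [N.Normal]
    (hN : N ≤ Subgroup.center G) (hH : N ≤ N.comap φ) :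
    algEnt (endRestrict φ N hH) + algEnt (QuotientGroup.map N N φ hH) ≤ algEnt φ := by
  refine ENNReal.biSup_add_biSup_le' ⟨⊥, by simp⟩ ⟨⊥, by simp⟩ ?_
  intro E hE Q hQ
  have hF0fin := hlf (Quotient.out '' (Q : Set (G ⧸ N))) (hQ.image _)
  set F0 := Subgroup.closure (Quotient.out '' (Q : Set (G ⧸ N))) with hF0
  have hmap : (QuotientGroup.mk' N) '' (F0 : Set G) = Q := by
    have : F0.map (QuotientGroup.mk' N) = Q := by
      rw [hF0, MonoidHom.map_closure, ← Set.image_comp]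
      have : (QuotientGroup.mk' N ∘ Quotient.out : G ⧸ N → G ⧸ N) = id := by
        ext q; exact QuotientGroup.out_eq' q
      rw [this, Set.image_id, Subgroup.closure_eq]
    rw [← this]; rfl
  have hEN : N.subtype '' (E : Set N) ⊆ N := by
    rintro _ ⟨x, _, rfl⟩; exact x.2
  have hnorm : (E.map N.subtype).Normal := normal_of_le_center (fun x hx => hN (hEN hx))
  have hFset : ((F0 ⊔ E.map N.subtype : Subgroup G) : Set G) =
      (F0 : Set G) * N.subtype '' (E : Set N) := by
    rw [Subgroup.mul_normal]; rfl
  set F := F0 ⊔ E.map N.subtype with hFdef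
  have hEfin : (N.subtype '' (E : Set N)).Finite := hE.image _
  have hFfin : (F : Set G).Finite := hFset ▸ hF0fin.mul hEfin
  refine le_trans ?_ (entH_le φ F hFfin)
  rw [← ENNReal.ofReal_add (entH_nonneg _ _ hE) (entH_nonneg _ _ hQ)]
  apply ENNReal.ofReal_le_ofReal
  refine le_of_tendsto_of_tendsto' ((tendsto_entH _ E hE).add (tendsto_entH _ Q hQ))
    (tendsto_entH φ F hFfin) fun n => ?_
  rw [← add_div]
  have h1 := ncard_traj_pos (endRestrict φ N hH) hE ⟨1, E.one_mem⟩ n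
  have h2 := ncard_traj_pos (QuotientGroup.map N N φ hH) hQ ⟨1, Q.one_mem⟩ n
  rw [← Real.log_mul (by positivity) (by positivity)]
  refine div_le_div_of_nonneg_right ?_ (by positivity)
  apply Real.log_le_log (by positivity)
  rw [hFset, entTraj_mul_central hN hH hEN,
    ← entTraj_image N.subtype (endRestrict φ N hH) φ (fun _ => rfl)]
  have h3 := ncard_mul_ge (N := N) (entTraj_finite φ hF0fin n) (entTraj_finite φ hEfin n)
    (entTraj_sub hH hEN n)
  rw [entTraj_image (QuotientGroup.mk' N) φ (QuotientGroup.map N N φ hH) (fun _ => rfl), hmap,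
    ← entTraj_image N.subtype (endRestrict φ N hH) φ (fun _ => rfl),
    Set.ncard_image_of_injective _ N.subtype_injective, mul_comm] at h3
  exact_mod_cast h3

/-- lifting the local condition from the quotient -/
lemma lift_good (hlf : IsLocallyFinite G) (φ : G →* G) (N : Subgroup G) [N.Normal]
    (hH : N ≤ N.comap φ)
    (hg : Good (QuotientGroup.map N N φ hH)) (F : Subgroup G) (hF : (F : Set G).Finite) :
    ∃ (m : ℕ) (A C : Set G) (B : Subgroup N), A.Finite ∧ A.Nonempty ∧
    C.Finite ∧ (B : Set N).Finite ∧
    A * φ^[m] '' (F : Set G) ⊆ C * φ '' A * N.subtype '' (B : Set N) ∧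
    ENNReal.ofReal (Real.log C.ncard) ≤ algEnt (QuotientGroup.map N N φ hH) := by
  have hFq : ((F.map (QuotientGroup.mk' N) : Subgroup (G ⧸ N)) : Set (G ⧸ N)).Finite := hF.image _
  obtain ⟨m, A, C, hA, hAne, hC, hAC, hlog⟩ := hg _ hFq
  let A' : Set G := Quotient.out '' A
  let C' : Set G := Quotient.out '' C
  have hA' : A'.Finite := hA.image _
  have hC' : C'.Finite := hC.image _
  have hFm : (φ^[m] '' (F : Set G)).Finite := hF.image _
  let W : Set G := (C' * φ '' A')⁻¹ * (A' * φ^[m] '' (F : Set G))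
  have hW : W.Finite := ((hC'.mul (hA'.image _)).inv).mul (hA'.mul hFm)
  let B : Subgroup N := Subgroup.closure (N.subtype ⁻¹' W)
  have hB : (B : Set N).Finite := by
    have h1 : (N.subtype '' (B : Set N)).Finite := by
      have h2 : B.map N.subtype = Subgroup.closure (N.subtype '' (N.subtype ⁻¹' W)) :=
        MonoidHom.map_closure _ _
      have h3 := hlf (N.subtype '' (N.subtype ⁻¹' W)) (hW.subset (Set.image_preimage_subset _ _))
      rw [← h2] at h3
      exact h3
    exact h1.of_finite_image N.subtype_injective.injOn
  refine ⟨m, A', C', B, hA', hAne.image _, hC', hB, ?_, ?_⟩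
  · rintro x hx
    have hx0 := hx
    obtain ⟨_, ⟨(a : G ⧸ N), ha, rfl⟩, _, ⟨f, hf, rfl⟩, rfl⟩ := hx
    change G ⧸ N at a
    have key : (a : G ⧸ N) * (QuotientGroup.map N N φ hH)^[m] (QuotientGroup.mk' N f) ∈
        C * (QuotientGroup.map N N φ hH) '' A :=
      hAC ⟨a, ha, _, ⟨_, ⟨f, hf, rfl⟩, rfl⟩, rfl⟩
    obtain ⟨c, hc, _, ⟨a', ha', rfl⟩, hca⟩ := key
    have hsemi : (QuotientGroup.map N N φ hH)^[m] (QuotientGroup.mk' N f) =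
        QuotientGroup.mk' N (φ^[m] f) :=
      ((Function.Semiconj.iterate_right (f := QuotientGroup.mk' N) (ga := φ)
        (gb := QuotientGroup.map N N φ hH) (fun _ => rfl) m) f).symm
    have hout : ∀ q : G ⧸ N, QuotientGroup.mk' N (Quotient.out q) = q :=
      fun q => QuotientGroup.out_eq' q
    have hy : Quotient.out c * φ (Quotient.out a') ∈ C' * φ '' A' :=
      ⟨_, ⟨c, hc, rfl⟩, _, ⟨_, ⟨a', ha', rfl⟩, rfl⟩, rfl⟩
    have hmem : (Quotient.out c * φ (Quotient.out a'))⁻¹ *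
        (Quotient.out a * φ^[m] f) ∈ N := by
      rw [← QuotientGroup.eq]
      change QuotientGroup.mk' N _ = QuotientGroup.mk' N _
      have hphi : QuotientGroup.mk' N (φ (Quotient.out a')) =
          QuotientGroup.map N N φ hH (QuotientGroup.mk' N (Quotient.out a')) := rfl
      rw [map_mul, map_mul, hphi, hout, hout, hout, ← hsemi]
      exact hca
    refine ⟨_, hy, _, ⟨⟨_, hmem⟩, Subgroup.subset_closure ?_, rfl⟩, ?_⟩
    · exact ⟨_, Set.inv_mem_inv.2 hy, _, hx0, rfl⟩
    · exact mul_inv_cancel_left _ _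
  · refine le_trans (ENNReal.ofReal_le_ofReal ?_) hlog
    have h : C'.ncard ≤ C.ncard := Set.ncard_image_le hC
    rcases Nat.eq_zero_or_pos C'.ncard with h0 | h0
    · rw [h0]; simpa using Real.log_natCast_nonneg C.ncard
    · exact Real.log_le_log (by positivity) (by exact_mod_cast h)

lemma upper_bound (hlf : IsLocallyFinite G) (φ : G →* G) (N : Subgroup G) [N.Normal]
    (hN : N ≤ Subgroup.center G) (hH : N ≤ N.comap φ)
    (hg : Good (QuotientGroup.map N N φ hH)) :
    algEnt φ ≤ algEnt (endRestrict φ N hH) + algEnt (QuotientGroup.map N N φ hH) := by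
  refine iSup₂_le fun F hF => ?_
  obtain ⟨m, A, C, B, hA, hAne, hC, hB, hsub, hlog⟩ := lift_good hlf φ N hH hg F hF
  have hFne : (F : Set G).Nonempty := ⟨1, F.one_mem⟩
  have hBN : N.subtype '' (B : Set N) ⊆ N := by
    rintro _ ⟨x, _, rfl⟩; exact x.2
  have hBf : (N.subtype '' (B : Set N)).Finite := hB.image _
  have hCne : C.Nonempty := by
    have : (A * φ^[m] '' (F : Set G)).Nonempty := hAne.mul (hFne.image _)
    exact ((this.mono hsub).of_mul_left).of_mul_left
  have hCpos : 0 < C.ncard := (Set.ncard_pos hC).2 hCne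
  have hApos : 0 < A.ncard := (Set.ncard_pos hA).2 hAne
  set Z := N.subtype '' (B : Set N) with hZ
  have hind : ∀ n, A * φ^[m] '' entTraj φ (F : Set G) n ⊆
      entTraj φ C n * φ^[n] '' A * entTraj φ Z n := by
    intro n
    induction n with
    | zero => simp [entTraj]
    | succ n ih =>
      rw [entTraj_succ, image_iter_mul, image_iter_iter, ← mul_assoc]
      calc _ ⊆ entTraj φ C n * φ^[n] '' A * entTraj φ Z n * φ^[m + n] '' (F : Set G) :=
            Set.mul_subset_mul_right ih
        _ = entTraj φ C n * φ^[n] '' (A * φ^[m] '' (F : Set G)) * entTraj φ Z n := by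
            rw [image_iter_mul, image_iter_iter, add_comm m n, mul_assoc,
              central_comm hN (entTraj_sub hH hBN n)]
            simp only [mul_assoc]
        _ ⊆ entTraj φ C n * φ^[n] '' (C * φ '' A * Z) * entTraj φ Z n :=
            Set.mul_subset_mul_right (Set.mul_subset_mul_left (Set.image_mono hsub))
        _ = _ := by
            rw [image_iter_mul, image_iter_mul, ← Set.image_comp, ← Function.iterate_succ,
              entTraj_succ, entTraj_succ]
            simp only [mul_assoc]
            rw [central_comm hN (entTraj_sub hH hBN n)]
  have hcount : ∀ n, (entTraj φ (F : Set G) n).ncard ≤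
      ((entTraj φ (F : Set G) m).ncard * A.ncard) *
        (C.ncard ^ n * (entTraj (endRestrict φ N hH) (B : Set N) n).ncard) := by
    intro n
    have hTn := entTraj_finite φ hF n
    have s1 : (entTraj φ (F : Set G) n).ncard ≤ (entTraj φ (F : Set G) (m + n)).ncard := by
      rw [add_comm]
      refine Set.ncard_le_ncard ?_ (entTraj_finite φ hF _)
      rw [entTraj_add]
      intro x hx
      refine ⟨x, hx, 1, ⟨1, ?_, iterate_map_one φ n⟩, mul_one x⟩
      exact one_mem_traj φ F.one_mem m
    have s2 : (φ^[m] '' entTraj φ (F : Set G) n).ncard ≤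
        (A * φ^[m] '' entTraj φ (F : Set G) n).ncard := by
      obtain ⟨a, ha⟩ := hAne
      refine Set.ncard_le_ncard_of_injOn (fun x => a * x) (fun x hx => ⟨a, ha, x, hx, rfl⟩)
        (fun x _ y _ h => mul_left_cancel h) (hA.mul (hTn.image _))
    have hfinR : (entTraj φ C n * φ^[n] '' A * entTraj φ Z n).Finite :=
      ((entTraj_finite φ hC n).mul (hA.image _)).mul (entTraj_finite φ hBf n)
    have s3 := Set.ncard_le_ncard (hind n) hfinR
    have s4 : (entTraj φ Z n).ncard = (entTraj (endRestrict φ N hH) (B : Set N) n).ncard := by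
      rw [hZ, ← entTraj_image N.subtype (endRestrict φ N hH) φ (fun _ => rfl),
        Set.ncard_image_of_injective _ N.subtype_injective]
    calc (entTraj φ (F : Set G) n).ncard ≤ _ := s1
      _ ≤ (entTraj φ (F : Set G) m).ncard * (φ^[m] '' entTraj φ (F : Set G) n).ncard := by
          rw [entTraj_add]; exact ncard_mul_le' _ _
      _ ≤ (entTraj φ (F : Set G) m).ncard * ((C.ncard ^ n * A.ncard) *
            (entTraj φ Z n).ncard) := by
          refine Nat.mul_le_mul le_rfl (s2.trans (s3.trans ?_))
          refine (ncard_mul_le' _ _).trans (Nat.mul_le_mul ?_ le_rfl)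
          refine (ncard_mul_le' _ _).trans (Nat.mul_le_mul (ncard_traj_le φ hC n) ?_)
          exact Set.ncard_image_le hA
      _ = _ := by rw [s4]; ring
  have hreal : entH φ F ≤ 0 + (Real.log C.ncard + entH (endRestrict φ N hH) B) := by
    refine le_of_tendsto_of_tendsto (tendsto_entH φ F hF)
      ((tendsto_const_div_atTop_nhds_zero_nat
        (Real.log ((entTraj φ (F : Set G) m).ncard * A.ncard))).add
        (tendsto_const_nhds.add (tendsto_entH _ B hB))) ?_
    filter_upwards [eventually_gt_atTop 0] with n hn
    have p1 := ncard_traj_pos φ hF hFne n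
    have p2 := ncard_traj_pos φ hF hFne m
    have p3 := ncard_traj_pos (endRestrict φ N hH) hB ⟨1, B.one_mem⟩ n
    have hn' : (0 : ℝ) < n := by exact_mod_cast hn
    have := Real.log_le_log (by positivity) (Nat.cast_le (α := ℝ).2 (hcount n))
    push_cast at this
    rw [Real.log_mul (by positivity) (by positivity),
      Real.log_mul (x := (C.ncard : ℝ) ^ n) (by positivity) (by positivity), Real.log_pow] at this
    calc _ ≤ _ := div_le_div_of_nonneg_right this hn'.le
      _ = _ := by field_simp
  rw [zero_add] at hreal
  calc ENNReal.ofReal (entH φ F) ≤ _ := ENNReal.ofReal_le_ofReal hreal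
    _ ≤ ENNReal.ofReal (Real.log C.ncard) + ENNReal.ofReal (entH (endRestrict φ N hH) B) :=
        ENNReal.ofReal_add_le
    _ ≤ _ := by rw [add_comm]; exact add_le_add (entH_le _ B hB) hlog

lemma good_ext (hlf : IsLocallyFinite G) (φ : G →* G) (N : Subgroup G) [N.Normal]
    (hN : N ≤ Subgroup.center G) (hH : N ≤ N.comap φ)
    (hg : Good (QuotientGroup.map N N φ hH)) : Good φ := by
  intro F hF
  have hFne : (F : Set G).Nonempty := ⟨1, F.one_mem⟩
  obtain ⟨m, A, C, B, hA, hAne, hC, hB, hsub, hlog⟩ := lift_good hlf φ N hH hg F hF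
  have hgN : Good (endRestrict φ N hH) := good_of_comm _ fun x y =>
    Subtype.ext (Subgroup.mem_center_iff.1 (hN y.2) x)
  obtain ⟨k, A1, C1, hA1, hA1ne, hC1, hsub1, hlog1⟩ := hgN B hB
  have him : ∀ X : Set N, N.subtype '' X ⊆ N := by
    rintro X _ ⟨x, _, rfl⟩; exact x.2
  have hsub2 : N.subtype '' A1 * φ^[k] '' (N.subtype '' (B : Set N)) ⊆
      N.subtype '' C1 * φ '' (N.subtype '' A1) := by
    have := Set.image_mono (f := N.subtype) hsub1
    rw [Set.image_mul, Set.image_mul, ← Set.image_comp, ← Set.image_comp] at this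
    rw [← Set.image_comp, ← Set.image_comp]
    have e : N.subtype ∘ (endRestrict φ N hH)^[k] = φ^[k] ∘ N.subtype :=
      (Function.Semiconj.iterate_right (f := N.subtype) (ga := endRestrict φ N hH)
        (gb := φ) (fun _ => rfl) k).comp_eq
    rw [e] at this
    exact this
  set A2 := N.subtype '' A1 with hA2
  set C2 := N.subtype '' C1 with hC2
  set Z := N.subtype '' (B : Set N) with hZ
  have hfin : (φ^[k] '' C * C2).Finite := (hC.image _).mul (hC1.image _)
  have hsubm : A2 * φ^[k] '' A * φ^[k + m] '' (F : Set G) ⊆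
      φ^[k] '' C * C2 * φ '' (A2 * φ^[k] '' A) := by
    rw [← image_iter_iter, mul_assoc, ← image_iter_mul]
    calc _ ⊆ A2 * φ^[k] '' (C * φ '' A * Z) := Set.mul_subset_mul_left (Set.image_mono hsub)
      _ = φ^[k] '' C * (A2 * φ^[k] '' Z) * φ^[k] '' (φ '' A) := by
          have c1 : ∀ X, A2 * X = X * A2 := central_comm hN (him A1)
          have c2 : ∀ X, φ^[k] '' Z * X = X * φ^[k] '' Z :=
            central_comm hN (image_iter_sub hH (him _) k)
          rw [image_iter_mul, image_iter_mul, ← mul_assoc A2, ← mul_assoc A2, c1 (φ^[k] '' C),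
            mul_assoc (φ^[k] '' C) (A2 * _), mul_assoc A2, c2]
          simp only [mul_assoc]
      _ ⊆ φ^[k] '' C * (C2 * φ '' A2) * φ^[k] '' (φ '' A) :=
          Set.mul_subset_mul_right (Set.mul_subset_mul_left hsub2)
      _ = _ := by
          have e : φ^[k] '' (φ '' A) = φ '' (φ^[k] '' A) := by
            rw [← Set.image_comp, ← Function.iterate_succ, ← Set.image_comp,
              ← Function.iterate_succ']
          rw [Set.image_mul, e]
          simp only [mul_assoc]
  refine ⟨k + m, A2 * φ^[k] '' A, φ^[k] '' C * C2, (hA1.image _).mul (hA.image _),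
    (hA1ne.image _).mul (hAne.image _), hfin, hsubm, ?_⟩
  refine le_trans ?_ (lower_bound hlf φ N hN hH)
  have hne : (φ^[k] '' C * C2).Nonempty :=
    (((((hA1ne.image _).mul (hAne.image _)).mul (hFne.image _)).mono hsubm)).of_mul_left
  have hCne : 0 < C.ncard := (Set.ncard_pos hC).2 hne.of_mul_left.of_image
  have hC1ne : 0 < C1.ncard := (Set.ncard_pos hC1).2 hne.of_mul_right.of_image
  have hpos := (Set.ncard_pos hfin).2 hne
  calc ENNReal.ofReal (Real.log (φ^[k] '' C * C2).ncard)
      ≤ ENNReal.ofReal (Real.log C1.ncard + Real.log C.ncard) := by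
        apply ENNReal.ofReal_le_ofReal
        rw [← Real.log_mul (by positivity) (by positivity)]
        apply Real.log_le_log (by positivity)
        rw [mul_comm]
        exact_mod_cast (ncard_mul_le' _ _).trans
          (Nat.mul_le_mul (Set.ncard_image_le hC) (Set.ncard_image_le hC1))
    _ ≤ _ := ENNReal.ofReal_add_le
    _ ≤ _ := add_le_add hlog1 hlog

lemma locfin_ext (htor : Monoid.IsTorsion G) (N : Subgroup G) [N.Normal]
    (hN : N ≤ Subgroup.center G) (hq : IsLocallyFinite (G ⧸ N)) : IsLocallyFinite G := by
  intro S hS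
  set H := Subgroup.closure S with hHdef
  have hfg : Group.FG H := by
    rw [Group.fg_iff_subgroup_fg]
    exact ⟨hS.toFinset, by simp [hHdef]⟩
  let f : H →* G ⧸ N := (QuotientGroup.mk' N).comp H.subtype
  have hfr : Finite f.range := by
    have h1 := hq (QuotientGroup.mk' N '' S) (hS.image _)
    have h2 : f.range = Subgroup.closure (QuotientGroup.mk' N '' S) := by
      rw [MonoidHom.range_comp, Subgroup.range_subtype, hHdef, MonoidHom.map_closure]
    rw [← h2] at h1
    exact h1
  have hidx : f.ker.FiniteIndex := Subgroup.finiteIndex_ker f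
  have hkfg : Group.FG f.ker := inferInstance
  have hcomm : ∀ x y : f.ker, x * y = y * x := by
    intro x y
    have hy : ((y : H) : G) ∈ N := (QuotientGroup.eq_one_iff _).1 y.2
    exact Subtype.ext (Subtype.ext (Subgroup.mem_center_iff.1 (hN hy) _))
  have hkfin : Finite f.ker := by
    let i : CommGroup f.ker := { (inferInstance : Group f.ker) with mul_comm := hcomm }
    have ht : Monoid.IsTorsion f.ker := (htor.subgroup H).subgroup f.ker
    exact @CommGroup.finite_of_fg_isMulTorsion f.ker i hkfg ht
  have : Nat.card H ≠ 0 := by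
    rw [← Subgroup.card_mul_index f.ker]
    exact mul_ne_zero Nat.card_pos.ne' hidx.index_ne_zero
  exact Set.finite_coe_iff.1 (Nat.finite_of_card_ne_zero this)

lemma lcs_le_center {n : ℕ} (h : Subgroup.lowerCentralSeries (⊤ : Subgroup G) (n + 1) = ⊥) :
    Subgroup.lowerCentralSeries (⊤ : Subgroup G) n ≤ Subgroup.center G := by
  rw [Subgroup.lowerCentralSeries_succ, Subgroup.commutator_eq_bot_iff_le_centralizer] at h
  rwa [Subgroup.coe_top, Subgroup.centralizer_univ] at h

end aux

theorem main_ind.{u} (n : ℕ) : ∀ (G : Type u) [Group G], Monoid.IsTorsion G →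
    Subgroup.lowerCentralSeries (⊤ : Subgroup G) n = ⊥ →
    IsLocallyFinite G ∧ ∀ φ : G →* G, Good φ := by
  induction n with
  | zero =>
    intro G _ _ h
    have hs : Subsingleton G := Subgroup.subsingleton_iff.1 (subsingleton_of_bot_eq_top h.symm)
    exact ⟨fun S _ => Set.toFinite _, fun φ => good_of_comm φ fun x y => Subsingleton.elim _ _⟩
  | succ n ih =>
    intro G _ ht h
    have hN := lcs_le_center h
    have hq := ih (G ⧸ Subgroup.lowerCentralSeries (⊤ : Subgroup G) n)
      (ht.of_surjective (QuotientGroup.mk'_surjective _)) (by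
        rw [← Subgroup.map_top_of_surjective _ (QuotientGroup.mk'_surjective
          (Subgroup.lowerCentralSeries (⊤ : Subgroup G) n)),
          ← Subgroup.map_lowerCentralSeries]
        exact QuotientGroup.map_mk'_self _)
    have hlf := locfin_ext ht _ hN hq.1
    exact ⟨hlf, fun φ => good_ext hlf φ _ hN (lowerCentralSeries_le_comap φ n) (hq.2 _)⟩

theorem main_AT.{u} (n : ℕ) (G : Type u) [Group G] (ht : Monoid.IsTorsion G)
    (h : Subgroup.lowerCentralSeries (⊤ : Subgroup G) (n + 1) = ⊥) (φ : G →* G) :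
    algEnt φ = algEnt (endRestrict φ (Subgroup.lowerCentralSeries (⊤ : Subgroup G) n)
        (lowerCentralSeries_le_comap φ n)) +
      algEnt (QuotientGroup.map _ _ φ (lowerCentralSeries_le_comap φ n)) := by
  have hN := lcs_le_center h
  have hq := main_ind n (G ⧸ Subgroup.lowerCentralSeries (⊤ : Subgroup G) n)
      (ht.of_surjective (QuotientGroup.mk'_surjective _)) (by
        rw [← Subgroup.map_top_of_surjective _ (QuotientGroup.mk'_surjective
          (Subgroup.lowerCentralSeries (⊤ : Subgroup G) n)),
          ← Subgroup.map_lowerCentralSeries]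
        exact QuotientGroup.map_mk'_self _)
  have hlf := locfin_ext ht _ hN hq.1
  exact le_antisymm (upper_bound hlf φ _ hN _ (hq.2 _)) (lower_bound hlf φ _ hN _)

end AlgEntropy

/-- If `G` is a torsion nilpotent group of nilpotency class `n`
(so `γ_n(G) = lowerCentralSeries G (n-1)` with `γ_1(G) = G`), then
`h(φ) = h(φ↾_{γ_n(G)}) + h(φ̄)` for every endomorphism `φ` of `G`. -/
theorem algEnt_eq_lowerCentral {G : Type*} [Group G] (htor : Monoid.IsTorsion G)
    [Group.IsNilpotent G] (n : ℕ) (hn : 0 < n) (hclass : Group.nilpotencyClass G = n)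
    (φ : G →* G) :
    AlgEntropy.algEnt φ =
      AlgEntropy.algEnt (AlgEntropy.endRestrict φ (Subgroup.lowerCentralSeries (⊤ : Subgroup G) (n - 1))
        (AlgEntropy.lowerCentralSeries_le_comap φ (n - 1))) +
      AlgEntropy.entQuot φ (Subgroup.lowerCentralSeries (⊤ : Subgroup G) (n - 1)) inferInstance
        (AlgEntropy.lowerCentralSeries_le_comap φ (n - 1)) := by
  obtain ⟨k, rfl⟩ : ∃ k, n = k + 1 := ⟨n - 1, by omega⟩
  have h : Subgroup.lowerCentralSeries (⊤ : Subgroup G) (k + 1) = ⊥ := by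
    rw [← hclass]; exact Subgroup.lowerCentralSeries_nilpotencyClass
  exact AlgEntropy.main_AT k G htor h φ
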